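/- arXiv:2506.14469 — 3 statements merged into one kernel-verified Lean document; each statement's English description precedes it below -/
import Mathlib

section
/- Let M be the symmetric 6×6 matrix with block structure (blocks of sizes 1, 2, 2, 1): row 1: [G̃_dc, 0, 0, τ*]; row block 2: [0, G·I₂, 0, 0]; row block 3: [0, 0, R·I₂, −μ v_dc*·Jψ*]; row 4: [τ*, 0, −μ v_dc*·(Jψ*)ᵀ, λγ], where τ* = (λη − 2μ(Jψ*)ᵀ i*_dq)/2, ψ* = (cos θ*, sin θ*), Jψ* = (sin θ*, −cos θ*), and i*_dq ∈ ℝ². Then for all ε₁, ε₂ > 0 and every x = (δv, δv_dq, δi_dq, δφ) ∈ ℝ × ℝ² × ℝ² × ℝ, the quadratic form of M satisfies xᵀMx ≥ (G̃_dc − (ε₁·‖i*_dq‖·μ)²)·δv² + G·‖δv_dq‖² + (R − ε₂²)·‖δi_dq‖² + (λγ − 1/ε₁² − (μ·v_dc*/ε₂)²)·δφ² + λη·δv·δφ. -/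
open Real Matrix

/-- The symmetric matrix `M` of the small-signal dissipation identity, with
`τ* = (λη − 2μ(Jψ*)ᵀi*_dq)/2`, `ψ* = (cos θ*, sin θ*)`, `Jψ* = (sin θ*, −cos θ*)`. -/
noncomputable def Mmat (Gt G R μ vs lam η γ θs : ℝ)
    (idq : EuclideanSpace ℝ (Fin 2)) : Matrix (Fin 6) (Fin 6) ℝ :=
  !![Gt, 0, 0, 0, 0, (lam * η - 2 * μ * (Real.sin θs * idq 0 - Real.cos θs * idq 1)) / 2;
     0, G, 0, 0, 0, 0;
     0, 0, G, 0, 0, 0;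
     0, 0, 0, R, 0, -(μ * vs * Real.sin θs);
     0, 0, 0, 0, R, μ * vs * Real.cos θs;
     (lam * η - 2 * μ * (Real.sin θs * idq 0 - Real.cos θs * idq 1)) / 2, 0, 0,
       -(μ * vs * Real.sin θs), μ * vs * Real.cos θs, lam * γ]

/-- Young's inequality for the component of a planar vector along `(sin θ, -cos θ)`. -/
lemma two_mul_mul_rotated_component_le (θ p q : ℝ) {ε : ℝ} (hε : ε ≠ 0)
    (x : EuclideanSpace ℝ (Fin 2)) :
    2 * p * q * (Real.sin θ * x 0 - Real.cos θ * x 1) ≤ (ε * p) ^ 2 * ‖x‖ ^ 2 + (q / ε) ^ 2 := by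
  have hcomp : (Real.sin θ * x 0 - Real.cos θ * x 1) ^ 2 ≤ ‖x‖ ^ 2 := by
    rw [EuclideanSpace.real_norm_sq_eq, Fin.sum_univ_two]
    linear_combination sq_nonneg (Real.cos θ * x 0 + Real.sin θ * x 1) +
      (x 0 ^ 2 + x 1 ^ 2) * Real.sin_sq_add_cos_sq θ
  set a := Real.sin θ * x 0 - Real.cos θ * x 1
  calc 2 * p * q * a = 2 * (ε * p * a) * (q / ε) := by field_simp
    _ ≤ (ε * p * a) ^ 2 + (q / ε) ^ 2 := two_mul_le_add_sq _ _
    _ = (ε * p) ^ 2 * a ^ 2 + (q / ε) ^ 2 := by ring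
    _ ≤ (ε * p) ^ 2 * ‖x‖ ^ 2 + (q / ε) ^ 2 := by gcongr

/-- Young-inequality lower bound on the quadratic form of `M`, valid for any `ε₁, ε₂ > 0`. -/
theorem Mmat_quadratic_form_lower_bound
    (Gt G R μ vs lam η γ θs : ℝ) (hμ : μ ∈ Set.Icc (0 : ℝ) 1)
    (idq : EuclideanSpace ℝ (Fin 2))
    (ε₁ ε₂ : ℝ) (hε₁ : 0 < ε₁) (hε₂ : 0 < ε₂) :
    ∀ (δv : ℝ) (δvdq δidq : EuclideanSpace ℝ (Fin 2)) (δφ : ℝ),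
      ![δv, δvdq 0, δvdq 1, δidq 0, δidq 1, δφ] ⬝ᵥ
        (Mmat Gt G R μ vs lam η γ θs idq).mulVec
          ![δv, δvdq 0, δvdq 1, δidq 0, δidq 1, δφ]
      ≥ (Gt - (ε₁ * ‖idq‖ * μ) ^ 2) * δv ^ 2 + G * ‖δvdq‖ ^ 2
        + (R - ε₂ ^ 2) * ‖δidq‖ ^ 2
        + (lam * γ - 1 / ε₁ ^ 2 - (μ * vs / ε₂) ^ 2) * δφ ^ 2
        + lam * η * δv * δφ := by
  intro δv δvdq δidq δφ
  have hvφ := two_mul_mul_rotated_component_le θs (μ * δv) δφ hε₁.ne' idq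
  have hiφ := two_mul_mul_rotated_component_le θs 1 (μ * vs * δφ) hε₂.ne' δidq
  have hv : ‖δvdq‖ ^ 2 = δvdq 0 ^ 2 + δvdq 1 ^ 2 := by
    rw [EuclideanSpace.real_norm_sq_eq, Fin.sum_univ_two]
  have hi : ‖δidq‖ ^ 2 = δidq 0 ^ 2 + δidq 1 ^ 2 := by
    rw [EuclideanSpace.real_norm_sq_eq, Fin.sum_univ_two]
  simp only [Mmat, dotProduct, mulVec, Fin.sum_univ_six, of_apply, cons_val, ge_iff_le]
  linear_combination hvφ + hiφ + G * hv + R * hi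
end

section
/- Let M be the symmetric 6×6 matrix with block structure (blocks of sizes 1, 2, 2, 1): row 1: [G̃_dc, 0, 0, τ*]; row block 2: [0, G·I₂, 0, 0]; row block 3: [0, 0, R·I₂, −μ v_dc*·Jψ*]; row 4: [τ*, 0, −μ v_dc*·(Jψ*)ᵀ, λγ], where τ* = (λη − 2μ(Jψ*)ᵀ i*_dq)/2, ψ* = (cos θ*, sin θ*), Jψ* = (sin θ*, −cos θ*). Suppose G > 0, μ ∈ [0,1], and there exist ε₁, ε₂ > 0 and λ > 0 such that: ε₂² < R; ε₁² < G̃_dc/(‖i*_dq‖·μ)² (i.e., (ε₁·‖i*_dq‖·μ)² < G̃_dc); and (λη/2)² < (λγ − 1/ε₁² − (μ·v_dc*/ε₂)²)·(G̃_dc − (ε₁·‖i*_dq‖·μ)²). Then M is positive definite. -/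
open Real Matrix

/-- A binary quadratic form with positive leading coefficient and negative discriminant is
positive away from the origin. -/
lemma binary_quadratic_pos {A B k a f : ℝ} (hA : 0 < A) (hk : k ^ 2 < B * A)
    (h : a ≠ 0 ∨ f ≠ 0) : 0 < A * a ^ 2 + 2 * k * a * f + B * f ^ 2 := by
  have key : A * (A * a ^ 2 + 2 * k * a * f + B * f ^ 2)
      = (A * a + k * f) ^ 2 + (B * A - k ^ 2) * f ^ 2 := by ring
  refine pos_of_mul_pos_right (key ▸ ?_) hA.le
  have hd : 0 < B * A - k ^ 2 := sub_pos.2 hk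
  by_cases hf : f = 0
  · have ha : a ≠ 0 := h.resolve_right (not_not.2 hf)
    subst hf
    simp only [mul_zero, add_zero, ne_eq, OfNat.ofNat_ne_zero, not_false_eq_true, zero_pow]
    positivity
  · positivity

/-- Decomposition of the quadratic form of `Mmat` into a binary form and nonnegative terms. -/
lemma Mmat_quadratic_form (Gt G R μ vs lam η γ θs : ℝ) (idq : EuclideanSpace ℝ (Fin 2))
    {ε₁ ε₂ : ℝ} (hε₁ : ε₁ ≠ 0) (hε₂ : ε₂ ≠ 0) (x : Fin 6 → ℝ) :
    x ⬝ᵥ (Mmat Gt G R μ vs lam η γ θs idq *ᵥ x) =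
      ((Gt - (ε₁ * ‖idq‖ * μ) ^ 2) * x 0 ^ 2 + 2 * (lam * η / 2) * x 0 * x 5
        + (lam * γ - 1 / ε₁ ^ 2 - (μ * vs / ε₂) ^ 2) * x 5 ^ 2)
      + G * (x 1 ^ 2 + x 2 ^ 2) + (R - ε₂ ^ 2) * (x 3 ^ 2 + x 4 ^ 2)
      + (ε₁ * μ * (sin θs * idq 0 - cos θs * idq 1) * x 0 - x 5 / ε₁) ^ 2
      + (ε₁ * μ * (cos θs * idq 0 + sin θs * idq 1) * x 0) ^ 2
      + (μ * vs * x 5 / ε₂ - ε₂ * (sin θs * x 3 - cos θs * x 4)) ^ 2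
      + (ε₂ * (cos θs * x 3 + sin θs * x 4)) ^ 2 := by
  have hn : ‖idq‖ ^ 2 = idq 0 ^ 2 + idq 1 ^ 2 := by
    simp [EuclideanSpace.real_norm_sq_eq, Fin.sum_univ_two]
  have hs : sin θs ^ 2 = 1 - cos θs ^ 2 := sin_sq θs
  simp only [Mmat, dotProduct, mulVec, Fin.sum_univ_six, mul_pow, hn]
  simp
  field_simp
  ring_nf
  simp only [hs]
  ring

/-- The decentralized small-signal passivity conditions of Hybrid-Angle Control imply
positive definiteness of the dissipation matrix `M`. -/
theorem Mmat_posDef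
    (Gt G R μ vs lam η γ θs : ℝ) (idq : EuclideanSpace ℝ (Fin 2))
    (hG : 0 < G) (hμ : μ ∈ Set.Icc (0 : ℝ) 1)
    (ε₁ ε₂ : ℝ) (hε₁ : 0 < ε₁) (hε₂ : 0 < ε₂) (hlam : 0 < lam)
    (hc1 : ε₂ ^ 2 < R)
    (hc2 : (ε₁ * ‖idq‖ * μ) ^ 2 < Gt)
    (hc3 : (lam * η / 2) ^ 2 <
      (lam * γ - 1 / ε₁ ^ 2 - (μ * vs / ε₂) ^ 2) * (Gt - (ε₁ * ‖idq‖ * μ) ^ 2)) :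
    (Mmat Gt G R μ vs lam η γ θs idq).PosDef := by
  refine PosDef.of_dotProduct_mulVec_pos ?_ fun x hx => ?_
  · ext i j
    fin_cases i <;> fin_cases j <;> simp [Mmat]
  rw [star_trivial, Mmat_quadratic_form _ _ _ _ _ _ _ _ _ _ hε₁.ne' hε₂.ne']
  have hA : 0 < Gt - (ε₁ * ‖idq‖ * μ) ^ 2 := sub_pos.2 hc2
  have hR : 0 < R - ε₂ ^ 2 := sub_pos.2 hc1
  by_cases h : x 0 ≠ 0 ∨ x 5 ≠ 0
  · have := binary_quadratic_pos hA hc3 h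
    positivity
  · obtain ⟨h0, h5⟩ : x 0 = 0 ∧ x 5 = 0 := by tauto
    have h' : x 1 ≠ 0 ∨ x 2 ≠ 0 ∨ x 3 ≠ 0 ∨ x 4 ≠ 0 := by
      contrapose! hx
      obtain ⟨h1, h2, h3, h4⟩ := hx
      ext i
      fin_cases i <;> assumption
    have hpos : 0 < G * (x 1 ^ 2 + x 2 ^ 2) + (R - ε₂ ^ 2) * (x 3 ^ 2 + x 4 ^ 2) := by
      rcases h' with h' | h' | h' | h' <;> positivity
    rw [h0, h5]
    simp only [mul_zero, ne_eq, OfNat.ofNat_ne_zero, not_false_eq_true, zero_pow, add_zero,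
      zero_add]
    positivity
end

section
/- (Small-signal passivity of HAC.) Let ψ* = (cos θ*, sin θ*), Jψ* = (sin θ*, −cos θ*), and define Ā as the 6×6 matrix with block rows [−G̃_dc, 0, −μψ*ᵀ, −2μ(Jψ*)ᵀ i*_dq], [0, −G·I₂ − Cω₀J, I₂, 0], [μψ*, −I₂, −R·I₂ − Lω₀J, 2μ v_dc*·Jψ*], [η/2, 0, 0, −γ/2] with J = [[0,1],[−1,0]]; let S = diag(C_dc, C, C, L, L, 1), A_lin = S⁻¹Ā, B_lin the 6×3 matrix with 1/C_dc in position (1,1) and (1/C)·I₂ in rows 2–3, columns 2–3, C_lin = [[1,0,0,0,0,0],[0,I₂,0,0]] (3×6), D_lin = 0, and P = diag(C_dc, C, C, L, L, 2λ). Suppose C_dc, C, L > 0, G > 0, μ ∈ [0,1], and there exist ε₁, ε₂ > 0 and λ > 0 such that ε₂² < R, (ε₁·‖i*_dq‖·μ)² < G̃_dc, and (λη/2)² < (λγ − 1/ε₁² − (μ·v_dc*/ε₂)²)·(G̃_dc − (ε₁·‖i*_dq‖·μ)²). Then P is positive definite and the KYP block matrix [[A_linᵀP + PA_lin, PB_lin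 − C_linᵀ], [B_linᵀP − C_lin, 0]] is negative semidefinite; hence the linearized HAC-controlled inverter is passive from (δi_dc, −δi_ℓ) to (δv_dc, δv_dq) with storage (1/2)x_linᵀ P x_lin. -/
open Real Matrix

/-- The linearized HAC dynamics matrix `Ā` (blocks of sizes 1, 2, 2, 1), with
`ψ* = (cos θ*, sin θ*)`, `Jψ* = (sin θ*, −cos θ*)`, `J = [[0,1],[−1,0]]`. -/
noncomputable def Abar (Gt G R C L ω₀ μ vs η γ θs : ℝ)
    (idq : EuclideanSpace ℝ (Fin 2)) : Matrix (Fin 6) (Fin 6) ℝ :=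
  !![-Gt, 0, 0, -(μ * Real.cos θs), -(μ * Real.sin θs),
       -(2 * μ * (Real.sin θs * idq 0 - Real.cos θs * idq 1));
     0, -G, -(C * ω₀), 1, 0, 0;
     0, C * ω₀, -G, 0, 1, 0;
     μ * Real.cos θs, -1, 0, -R, -(L * ω₀), 2 * μ * vs * Real.sin θs;
     μ * Real.sin θs, 0, -1, L * ω₀, -R, -(2 * μ * vs * Real.cos θs);
     η / 2, 0, 0, 0, 0, -(γ / 2)]

/-- The scaling matrix `S = diag(C_dc, C, C, L, L, 1)`. -/
noncomputable def Smat (Cdc C L : ℝ) : Matrix (Fin 6) (Fin 6) ℝ :=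
  Matrix.diagonal ![Cdc, C, C, L, L, 1]

/-- The input matrix `B_lin`. -/
noncomputable def Blin (Cdc C : ℝ) : Matrix (Fin 6) (Fin 3) ℝ :=
  !![1 / Cdc, 0, 0; 0, 1 / C, 0; 0, 0, 1 / C; 0, 0, 0; 0, 0, 0; 0, 0, 0]

/-- The output matrix `C_lin`. -/
noncomputable def Clin : Matrix (Fin 3) (Fin 6) ℝ :=
  !![1, 0, 0, 0, 0, 0; 0, 1, 0, 0, 0, 0; 0, 0, 1, 0, 0, 0]

/-- The storage matrix `P = diag(C_dc, C, C, L, L, 2λ)`. -/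
noncomputable def Pmat (Cdc C L lam : ℝ) : Matrix (Fin 6) (Fin 6) ℝ :=
  Matrix.diagonal ![Cdc, C, C, L, L, 2 * lam]

theorem Pmat_mul_inv_Smat {Cdc C L : ℝ} (hCdc : Cdc ≠ 0) (hC : C ≠ 0) (hL : L ≠ 0) (lam : ℝ) :
    Pmat Cdc C L lam * (Smat Cdc C L)⁻¹ = Matrix.diagonal ![1, 1, 1, 1, 1, 2 * lam] := by
  have hS : (Smat Cdc C L)⁻¹ = Matrix.diagonal ![Cdc⁻¹, C⁻¹, C⁻¹, L⁻¹, L⁻¹, 1] := by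
    apply Matrix.inv_eq_right_inv
    rw [Smat, Matrix.diagonal_mul_diagonal, ← Matrix.diagonal_one]
    congr 1
    ext i
    fin_cases i <;> simp [hCdc, hC, hL]
  rw [hS, Pmat, Matrix.diagonal_mul_diagonal]
  congr 1
  ext i
  fin_cases i <;> simp [hCdc, hC, hL]

theorem Pmat_mul_Blin {Cdc C : ℝ} (hCdc : Cdc ≠ 0) (hC : C ≠ 0) (L lam : ℝ) :
    Pmat Cdc C L lam * Blin Cdc C = Clinᵀ := by
  ext i j
  rw [Pmat, Matrix.diagonal_mul]
  fin_cases i <;> fin_cases j <;> simp [Blin, Clin, hCdc, hC]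

theorem Pmat_posDef {Cdc C L lam : ℝ} (hCdc : 0 < Cdc) (hC : 0 < C) (hL : 0 < L)
    (hlam : 0 < lam) : (Pmat Cdc C L lam).PosDef := by
  refine Matrix.PosDef.diagonal fun i => ?_
  fin_cases i <;> simp [hCdc, hC, hL, hlam]

/-- Cauchy–Schwarz against the unit vector `(sin θ, -cos θ)`. -/
theorem sq_sin_mul_sub_cos_mul_le (θ a b : ℝ) :
    (Real.sin θ * a - Real.cos θ * b) ^ 2 ≤ a ^ 2 + b ^ 2 := by
  nlinarith [sq_nonneg (Real.cos θ * a + Real.sin θ * b), Real.sin_sq_add_cos_sq θ,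
    congrArg (· * (a ^ 2 + b ^ 2)) (Real.sin_sq_add_cos_sq θ)]

/-- A binary quadratic form with positive leading coefficient and nonpositive discriminant
is nonnegative. -/
theorem binary_form_nonneg {a b g : ℝ} (hg : 0 < g) (h : b ^ 2 ≤ a * g) (v φ : ℝ) :
    0 ≤ g * v ^ 2 - 2 * b * v * φ + a * φ ^ 2 := by
  have : 0 ≤ g * (g * v ^ 2 - 2 * b * v * φ + a * φ ^ 2) := by
    nlinarith [sq_nonneg (g * v - b * φ), mul_nonneg (sub_nonneg.2 h) (sq_nonneg φ)]
  exact nonneg_of_mul_nonneg_right this hg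

/-- The dissipated power of the linearized inverter is nonnegative. -/
theorem hac_dissipation_nonneg {Gt G R μ η γ vs n k ε₁ ε₂ lam : ℝ} (hG : 0 ≤ G)
    (hε₁ : 0 < ε₁) (hε₂ : 0 < ε₂) (hc1 : ε₂ ^ 2 ≤ R) (hk : k ^ 2 ≤ n ^ 2)
    (hc2 : (ε₁ * n * μ) ^ 2 < Gt)
    (hc3 : (lam * η / 2) ^ 2 ≤
      (lam * γ - 1 / ε₁ ^ 2 - (μ * vs / ε₂) ^ 2) * (Gt - (ε₁ * n * μ) ^ 2))
    (θ v w₀ w₁ i₀ i₁ φ : ℝ) :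
    0 ≤ Gt * v ^ 2 + G * (w₀ ^ 2 + w₁ ^ 2) + R * (i₀ ^ 2 + i₁ ^ 2) + lam * γ * φ ^ 2
      + 2 * μ * k * v * φ - lam * η * v * φ
      - 2 * μ * vs * (Real.sin θ * i₀ - Real.cos θ * i₁) * φ := by
  have hform := binary_form_nonneg (sub_pos.2 hc2) hc3 v φ
  have hvolt : 0 ≤ (ε₁ * n * μ) ^ 2 * v ^ 2 + 2 * μ * k * v * φ + 1 / ε₁ ^ 2 * φ ^ 2 := by
    have hsq : (ε₁ * μ * k * v + φ / ε₁) ^ 2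
        = ε₁ ^ 2 * μ ^ 2 * v ^ 2 * k ^ 2 + 2 * μ * k * v * φ + 1 / ε₁ ^ 2 * φ ^ 2 := by
      field_simp
      ring
    have hmono := mul_le_mul_of_nonneg_left hk (by positivity : 0 ≤ ε₁ ^ 2 * μ ^ 2 * v ^ 2)
    linarith [sq_nonneg (ε₁ * μ * k * v + φ / ε₁)]
  have hcurr : 0 ≤ R * (i₀ ^ 2 + i₁ ^ 2) + (μ * vs / ε₂) ^ 2 * φ ^ 2
      - 2 * μ * vs * (Real.sin θ * i₀ - Real.cos θ * i₁) * φ := by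
    set q := Real.sin θ * i₀ - Real.cos θ * i₁
    have hqle : q ^ 2 ≤ i₀ ^ 2 + i₁ ^ 2 := sq_sin_mul_sub_cos_mul_le θ i₀ i₁
    have hsq : (ε₂ * q - μ * vs / ε₂ * φ) ^ 2
        = ε₂ ^ 2 * q ^ 2 + (μ * vs / ε₂) ^ 2 * φ ^ 2 - 2 * μ * vs * q * φ := by
      field_simp
      ring
    have h₁ := mul_le_mul_of_nonneg_left hqle (sq_nonneg ε₂)
    have h₂ := mul_le_mul_of_nonneg_right hc1 (by positivity : 0 ≤ i₀ ^ 2 + i₁ ^ 2)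
    linarith [sq_nonneg (ε₂ * q - μ * vs / ε₂ * φ)]
  have hcap : 0 ≤ G * (w₀ ^ 2 + w₁ ^ 2) := by positivity
  linarith

/-- **Small-signal passivity of HAC.** Under the decentralized gain conditions, the storage
matrix `P` is positive definite and the KYP block matrix
`[[A_linᵀP + PA_lin, PB_lin − C_linᵀ], [B_linᵀP − C_lin, 0]]` is negative semidefinite
(with `A_lin = S⁻¹Ā` and `D_lin = 0`), so the linearized HAC-controlled inverter is passive
from `(δi_dc, −δi_ℓ)` to `(δv_dc, δv_dq)` with storage `(1/2)x_linᵀPx_lin`. -/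
theorem hac_small_signal_passive
    (Cdc C L : ℝ) (hCdc : 0 < Cdc) (hC : 0 < C) (hL : 0 < L)
    (Gt G R : ℝ) (hG : 0 < G)
    (μ : ℝ) (hμ : μ ∈ Set.Icc (0 : ℝ) 1)
    (ω₀ η γ vs θs : ℝ) (idq : EuclideanSpace ℝ (Fin 2))
    (ε₁ ε₂ lam : ℝ) (hε₁ : 0 < ε₁) (hε₂ : 0 < ε₂) (hlam : 0 < lam)
    (hc1 : ε₂ ^ 2 < R)
    (hc2 : (ε₁ * ‖idq‖ * μ) ^ 2 < Gt)
    (hc3 : (lam * η / 2) ^ 2 <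
      (lam * γ - 1 / ε₁ ^ 2 - (μ * vs / ε₂) ^ 2) * (Gt - (ε₁ * ‖idq‖ * μ) ^ 2)) :
    (Pmat Cdc C L lam).PosDef ∧
    (-(Matrix.fromBlocks
        (((Smat Cdc C L)⁻¹ * Abar Gt G R C L ω₀ μ vs η γ θs idq)ᵀ * Pmat Cdc C L lam
          + Pmat Cdc C L lam * ((Smat Cdc C L)⁻¹ * Abar Gt G R C L ω₀ μ vs η γ θs idq))
        (Pmat Cdc C L lam * Blin Cdc C - Clinᵀ)
        ((Blin Cdc C)ᵀ * Pmat Cdc C L lam - Clin)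
        (0 : Matrix (Fin 3) (Fin 3) ℝ))).PosSemidef := by
  have hP := Pmat_posDef hCdc hC hL hlam
  refine ⟨hP, ?_⟩
  have hPB := Pmat_mul_Blin hCdc.ne' hC.ne' L lam
  have hPT : (Pmat Cdc C L lam)ᵀ = Pmat Cdc C L lam := Matrix.diagonal_transpose _
  have hBP : (Blin Cdc C)ᵀ * Pmat Cdc C L lam = Clin := by
    rw [← Matrix.transpose_transpose Clin, ← hPB, Matrix.transpose_mul, hPT]
  have hPA : Pmat Cdc C L lam * ((Smat Cdc C L)⁻¹ * Abar Gt G R C L ω₀ μ vs η γ θs idq)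
      = Matrix.diagonal ![1, 1, 1, 1, 1, 2 * lam] * Abar Gt G R C L ω₀ μ vs η γ θs idq := by
    rw [← Matrix.mul_assoc, Pmat_mul_inv_Smat hCdc.ne' hC.ne' hL.ne']
  have hAP : ((Smat Cdc C L)⁻¹ * Abar Gt G R C L ω₀ μ vs η γ θs idq)ᵀ * Pmat Cdc C L lam
      = (Matrix.diagonal ![1, 1, 1, 1, 1, 2 * lam] * Abar Gt G R C L ω₀ μ vs η γ θs idq)ᵀ := by
    rw [← hPA, Matrix.transpose_mul (Pmat Cdc C L lam), hPT]
  rw [hPB, hBP, sub_self, sub_self, hPA, hAP]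
  set M := Matrix.diagonal ![1, 1, 1, 1, 1, 2 * lam] * Abar Gt G R C L ω₀ μ vs η γ θs idq with hM
  refine Matrix.PosSemidef.of_dotProduct_mulVec_nonneg ?_ fun z => ?_
  · rw [Matrix.IsHermitian, Matrix.conjTranspose_eq_transpose_of_trivial, Matrix.transpose_neg,
      Matrix.fromBlocks_transpose]
    simp [add_comm]
  · have hk : (Real.sin θs * idq 0 - Real.cos θs * idq 1) ^ 2 ≤ ‖idq‖ ^ 2 := by
      rw [EuclideanSpace.real_norm_sq_eq, Fin.sum_univ_two]
      exact sq_sin_mul_sub_cos_mul_le θs _ _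
    have hdiss := hac_dissipation_nonneg hG.le hε₁ hε₂ hc1.le hk hc2 hc3.le θs
      (z (.inl 0)) (z (.inl 1)) (z (.inl 2)) (z (.inl 3)) (z (.inl 4)) (z (.inl 5))
    refine (mul_nonneg zero_le_two hdiss).trans_eq ?_
    simp only [dotProduct, Matrix.mulVec, Fintype.sum_sum_type, Matrix.neg_apply,
      Matrix.fromBlocks_apply₁₁, Matrix.fromBlocks_apply₁₂, Matrix.fromBlocks_apply₂₁,
      Matrix.fromBlocks_apply₂₂, Matrix.add_apply, Matrix.transpose_apply, Matrix.zero_apply,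
      hM, Matrix.diagonal_mul, Fin.sum_univ_six, star_trivial, Pi.star_apply]
    simp [Abar]
    ring
end
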